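/- arXiv:2309.11885 — 2 statements merged into one kernel-verified Lean document; each statement's English description precedes it below -/
import Mathlib

section
/- The maximum over vertices u of the local mean subtree order μ(T; u) of a finite tree T is attained at a vertex of degree at most 2 (i.e., at a leaf or a vertex of degree 2). -/
open Finset Polynomial

variable {V : Type*}

/-- The vertex sets of the subtrees of `G` that lie inside the set `S` and contain
the vertex `w` : nonempty connected induced subgraphs. -/
noncomputable def subtreesIn [Fintype V] [DecidableEq V] (G : SimpleGraph V) (S : Set V)
    (w : V) : Finset (Finset V) := by
  classical
  exact Finset.univ.filter fun A => w ∈ A ∧ (A : Set V) ⊆ S ∧ (G.induce (A : Set V)).Connected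

/-- The vertex sets of the subtrees of `G` containing `w`. -/
noncomputable def subtrees [Fintype V] [DecidableEq V] (G : SimpleGraph V) (w : V) :
    Finset (Finset V) := subtreesIn G Set.univ w

/-- The generating polynomial `φ_{T,w}` of subtrees of `G` inside `S` containing `w`,
counted by order. -/
noncomputable def subtreePolyIn [Fintype V] [DecidableEq V] (G : SimpleGraph V) (S : Set V)
    (w : V) : Polynomial ℝ := ∑ A ∈ subtreesIn G S w, X ^ A.card

/-- The generating polynomial `φ_{T,w}` of subtrees of `G` containing `w`. -/
noncomputable def subtreePoly [Fintype V] [DecidableEq V] (G : SimpleGraph V) (w : V) :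
    Polynomial ℝ := subtreePolyIn G Set.univ w

/-- The local mean subtree order `μ(G; w)`: the average order of subtrees of `G`
containing `w`. -/
noncomputable def meanOrder [Fintype V] [DecidableEq V] (G : SimpleGraph V) (w : V) : ℝ :=
  (∑ A ∈ subtrees G w, (A.card : ℝ)) / ((subtrees G w).card : ℝ)

/-- The vertex set of the connected component of `G - D` containing `w`. -/
def compDel (G : SimpleGraph V) (D : Set V) (w : V) : Set V :=
  {x | ∃ p : G.Walk w x, ∀ y ∈ p.support, y ∉ D}

/-- The neighbours of `u` as a `Finset`. -/
noncomputable def nbrFinset [Fintype V] (G : SimpleGraph V) (u : V) : Finset V := by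
  classical
  exact Finset.univ.filter fun w => G.Adj u w

/-- `G` is a path: a tree all of whose vertices have degree at most `2`. -/
def IsPathGraph [Fintype V] (G : SimpleGraph V) : Prop :=
  G.IsTree ∧ ∀ v : V, (G.neighborSet v).ncard ≤ 2

/-- The induced subgraph of `G` on `S` is a path (as a subgraph of a tree:
connected with all degrees within `S` at most `2`). -/
def IsPathOn (G : SimpleGraph V) (S : Set V) : Prop :=
  (G.induce S).Connected ∧ ∀ x ∈ S, (G.neighborSet x ∩ S).ncard ≤ 2

/-- The partial Kelmans operation on `G` from `v` to `u`, moving the edges between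
`v` and the set `W`: each edge `v w`, `w ∈ W`, is replaced by the edge `u w`. -/
def pkelmans (G : SimpleGraph V) (v u : V) (W : Set V) : SimpleGraph V :=
  SimpleGraph.fromRel fun a b =>
    (G.Adj a b ∧ ¬(a = v ∧ b ∈ W) ∧ ¬(b = v ∧ a ∈ W)) ∨
    (a = u ∧ b ∈ W ∧ G.Adj v b)

/-- The Kelmans operation on `G` from `v` to `u`: every edge `v w` with
`w ∈ N(v) \ {u}` is replaced by the edge `u w`. -/
def kelmans (G : SimpleGraph V) (v u : V) : SimpleGraph V :=
  pkelmans G v u (G.neighborSet v \ {u})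

theorem one_add_sum_le_prod_one_add_of_nonneg {ι : Type*} {s : Finset ι} {a : ι → ℝ}
    (ha : ∀ i ∈ s, 0 ≤ a i) : 1 + ∑ i ∈ s, a i ≤ ∏ i ∈ s, (1 + a i) := by
  induction s using Finset.cons_induction with
  | empty => simp
  | cons i s hi ih =>
    rw [sum_cons, prod_cons]
    have h0 := ha i (mem_cons_self i s)
    have hs : ∀ j ∈ s, 0 ≤ a j := fun j hj => ha j (mem_cons_of_mem hj)
    nlinarith [mul_le_mul_of_nonneg_left (ih hs) h0, mul_nonneg h0 (sum_nonneg hs), ih hs]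

section Connectivity

variable {G : SimpleGraph V}

/-- An induced subgraph is connected iff every part containing a given vertex and closed under
adjacency is everything. -/
theorem induce_connected_iff_of_mem {A : Set V} {v : V} (hv : v ∈ A) :
    (G.induce A).Connected ↔
      ∀ C : Set V, v ∈ C → (∀ x ∈ C, ∀ y ∈ A, G.Adj x y → y ∈ C) → A ⊆ C := by
  constructor
  · intro h C hvC hC x hx
    obtain ⟨p⟩ := h.preconnected ⟨v, hv⟩ ⟨x, hx⟩
    have key : ∀ a b : A, (G.induce A).Walk a b → (a : V) ∈ C → (b : V) ∈ C := by
      intro a b p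
      induction p with
      | nil => exact id
      | cons hab _ ih => exact fun ha => ih (hC _ ha _ (Subtype.property _) hab)
    exact key _ _ p hvC
  · intro h
    have hsub := h {x | ∃ hx : x ∈ A, (G.induce A).Reachable ⟨v, hv⟩ ⟨x, hx⟩}
      ⟨hv, SimpleGraph.Reachable.refl _⟩ (by
        rintro x ⟨hx, hr⟩ y hy hxy
        have hadj : (G.induce A).Adj ⟨x, hx⟩ ⟨y, hy⟩ := hxy
        exact ⟨hy, hr.trans hadj.reachable⟩)
    rw [SimpleGraph.connected_iff_exists_forall_reachable]
    refine ⟨⟨v, hv⟩, fun x => ?_⟩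
    obtain ⟨_, hr⟩ := hsub x.2
    exact hr

/-- In a tree, two neighbours of `v` joined by a walk avoiding `v` are equal. -/
theorem SimpleGraph.IsTree.eq_of_mem_compDel (hG : G.IsTree) {v w w' : V} (hw : G.Adj v w)
    (hw' : G.Adj v w') (h : w' ∈ compDel G {v} w) : w = w' := by
  classical
  obtain ⟨p, hp⟩ := h
  have hvp : v ∉ p.bypass.support := fun hv => hp v (p.support_bypass_subset_support hv) rfl
  have hpath : (SimpleGraph.Walk.cons hw p.bypass).IsPath :=
    (SimpleGraph.Walk.cons_isPath_iff _ _).2 ⟨p.bypass_isPath, hvp⟩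
  have hpath' : (SimpleGraph.Walk.cons hw' SimpleGraph.Walk.nil).IsPath := by
    simp [hw'.ne]
  have heq := (hG.existsUnique_path v w').unique hpath hpath'
  have hlen := congrArg SimpleGraph.Walk.length heq
  simp only [SimpleGraph.Walk.length_cons, SimpleGraph.Walk.length_nil] at hlen
  exact SimpleGraph.Walk.eq_of_length_eq_zero (p := p.bypass) (by omega)

theorem mem_compDel_self {v w : V} (h : w ≠ v) : w ∈ compDel G {v} w :=
  ⟨SimpleGraph.Walk.nil, by simpa using h⟩

theorem notMem_compDel {v w : V} : v ∉ compDel G {v} w :=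
  fun ⟨p, hp⟩ => hp v p.end_mem_support rfl

theorem compDel_symm {D : Set V} {x y : V} (h : x ∈ compDel G D y) : y ∈ compDel G D x := by
  obtain ⟨p, hp⟩ := h
  exact ⟨p.reverse, by simpa using hp⟩

theorem compDel_trans {D : Set V} {x y z : V} (h : y ∈ compDel G D x) (h' : z ∈ compDel G D y) :
    z ∈ compDel G D x := by
  obtain ⟨p, hp⟩ := h
  obtain ⟨q, hq⟩ := h'
  refine ⟨p.append q, fun t ht => ?_⟩
  rcases (SimpleGraph.Walk.mem_support_append_iff _ _).1 ht with ht | ht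
  exacts [hp t ht, hq t ht]

theorem mem_compDel_of_adj {D : Set V} {x y : V} (h : G.Adj x y) (hx : x ∉ D) (hy : y ∉ D) :
    y ∈ compDel G D x :=
  ⟨h.toWalk, by simp [hx, hy]⟩

/-- The vertex `v` together with the branches at `v` through the vertices in `W`. -/
def starBranches (G : SimpleGraph V) (v : V) (W : Set V) : Set V :=
  {v} ∪ ⋃ w ∈ W, compDel G {v} w

/-- The edge `v w` is the only edge between the disjoint sets `P ∋ v` and `Q ∋ w`. -/
structure IsBridgeBetween (G : SimpleGraph V) (P Q : Set V) (v w : V) : Prop where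
  disjoint : Disjoint P Q
  left_mem : v ∈ P
  right_mem : w ∈ Q
  adj : G.Adj v w
  eq_of_adj : ∀ x ∈ P, ∀ y ∈ Q, G.Adj x y → x = v ∧ y = w

theorem IsBridgeBetween.symm {P Q : Set V} {v w : V} (h : IsBridgeBetween G P Q v w) :
    IsBridgeBetween G Q P w v :=
  ⟨h.disjoint.symm, h.right_mem, h.left_mem, h.adj.symm,
    fun x hx y hy hxy => (h.eq_of_adj y hy x hx hxy.symm).symm⟩

theorem SimpleGraph.IsTree.isBridgeBetween_starBranches (hG : G.IsTree) {v w : V} {W : Set V}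
    (hw : G.Adj v w) (hW : W ⊆ G.neighborSet v) (hwW : w ∉ W) :
    IsBridgeBetween G (starBranches G v W) (compDel G {v} w) v w := by
  have hdisj : ∀ w' ∈ W, ∀ x ∈ compDel G {v} w', x ∉ compDel G {v} w := by
    intro w' hw' x hx hx'
    have := hG.eq_of_mem_compDel hw (hW hw') (compDel_trans hx' (compDel_symm hx))
    exact hwW (this ▸ hw')
  refine ⟨?_, Or.inl rfl, mem_compDel_self hw.ne', hw, ?_⟩
  · rw [Set.disjoint_left]
    rintro x (rfl | hx)
    · exact notMem_compDel
    · obtain ⟨w', hw', hx⟩ := Set.mem_iUnion₂.1 hx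
      exact hdisj w' hw' x hx
  · rintro x (rfl | hx) y hy hxy
    · exact ⟨rfl, (hG.eq_of_mem_compDel hw hxy hy).symm⟩
    · obtain ⟨w', hw', hx⟩ := Set.mem_iUnion₂.1 hx
      have hxv : x ∉ ({v} : Set V) := fun h => notMem_compDel (h ▸ hx)
      have hyv : y ∉ ({v} : Set V) := fun h => notMem_compDel (h ▸ hy)
      exact absurd (compDel_trans hy (mem_compDel_of_adj hxy.symm hyv hxv)) (hdisj w' hw' x hx)

theorem starBranches_insert (v w : V) (W : Set V) :
    starBranches G v (insert w W) = starBranches G v W ∪ compDel G {v} w := by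
  rw [starBranches, starBranches, Set.biUnion_insert, Set.union_assoc,
    Set.union_comm (compDel G {v} w)]

theorem SimpleGraph.Connected.starBranches_neighborSet (hG : G.Connected) (v : V) :
    starBranches G v (G.neighborSet v) = Set.univ := by
  classical
  refine Set.eq_univ_of_forall fun x => ?_
  obtain ⟨p, hp⟩ := (hG.preconnected v x).exists_isPath
  cases p with
  | nil => exact Or.inl rfl
  | @cons _ w _ hw q =>
    rw [SimpleGraph.Walk.cons_isPath_iff] at hp
    refine Or.inr (Set.mem_iUnion₂.2 ⟨w, hw, q, fun y hy hyv => hp.2 ?_⟩)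
    rw [← Set.mem_singleton_iff.1 hyv]
    exact hy

theorem IsBridgeBetween.induce_connected_union_iff {P Q A B : Set V} {v w : V}
    (h : IsBridgeBetween G P Q v w) (hA : A ⊆ P) (hB : B ⊆ Q) (hv : v ∈ A) :
    (G.induce (A ∪ B)).Connected ↔
      (G.induce A).Connected ∧ (B = ∅ ∨ w ∈ B ∧ (G.induce B).Connected) := by
  rw [induce_connected_iff_of_mem (Set.mem_union_left B hv), induce_connected_iff_of_mem hv]
  have hdisj : ∀ x ∈ A, x ∉ B := fun x hx hx' => Set.disjoint_left.1 h.disjoint (hA hx) (hB hx')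
  constructor
  · intro hAB
    refine ⟨fun C hvC hC x hx => ?_, ?_⟩
    · refine (hAB (C ∩ A ∪ B) (Or.inl ⟨hvC, hv⟩) ?_ (Or.inl hx)).elim And.left
        fun hxB => absurd hxB (hdisj x hx)
      rintro y hy z (hz | hz) hyz
      · rcases hy with hy | hy
        · exact Or.inl ⟨hC y hy.1 z hz hyz, hz⟩
        · obtain rfl := (h.eq_of_adj z (hA hz) y (hB hy) hyz.symm).1
          exact Or.inl ⟨hvC, hv⟩
      · exact Or.inr hz
    · by_cases hwB : w ∈ B
      · refine Or.inr ⟨hwB, (induce_connected_iff_of_mem hwB).2 fun C hwC hC x hx => ?_⟩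
        refine (hAB (A ∪ C) (Or.inl hv) ?_ (Or.inr hx)).elim
          (fun hxA => absurd hx (hdisj x hxA)) id
        rintro y hy z (hz | hz) hyz
        · exact Or.inl hz
        · rcases hy with hy | hy
          · obtain rfl := (h.eq_of_adj y (hA hy) z (hB hz) hyz).2
            exact Or.inr hwC
          · exact Or.inr (hC y hy z hz hyz)
      · refine Or.inl (Set.eq_empty_of_forall_notMem fun x hx => hdisj x ?_ hx)
        refine hAB A hv ?_ (Or.inr hx)
        rintro y hy z (hz | hz) hyz
        · exact hz
        · obtain rfl := (h.eq_of_adj y (hA hy) z (hB hz) hyz).2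
          exact absurd hz hwB
  · rintro ⟨hAc, hBc⟩ C hvC hC
    have hAC : A ⊆ C := hAc C hvC fun x hx y hy => hC x hx y (Or.inl hy)
    refine Set.union_subset hAC ?_
    rcases hBc with rfl | ⟨hwB, hBc⟩
    · exact Set.empty_subset _
    · exact (induce_connected_iff_of_mem hwB).1 hBc C (hC v hvC w (Or.inr hwB) h.adj)
        fun x hx y hy => hC x hx y (Or.inr hy)

end Connectivity

section Counting

variable [Fintype V] [DecidableEq V] {G : SimpleGraph V}

theorem mem_subtreesIn {S : Set V} {w : V} {A : Finset V} :
    A ∈ subtreesIn G S w ↔ w ∈ A ∧ (A : Set V) ⊆ S ∧ (G.induce (A : Set V)).Connected := by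
  simp [subtreesIn]

theorem singleton_mem_subtreesIn {S : Set V} {w : V} (hw : w ∈ S) : {w} ∈ subtreesIn G S w := by
  rw [mem_subtreesIn]
  refine ⟨by simp, by simpa using hw, ?_⟩
  rw [induce_connected_iff_of_mem (by simp : w ∈ (({w} : Finset V) : Set V))]
  intro C hC _
  simpa using hC

theorem IsBridgeBetween.sum_subtreesIn_union {P Q : Set V} {v w : V}
    (h : IsBridgeBetween G P Q v w) (f : Finset V → ℝ) :
    ∑ A ∈ subtreesIn G (P ∪ Q) v, f A =
      ∑ A ∈ subtreesIn G P v, (f A + ∑ B ∈ subtreesIn G Q w, f (A ∪ B)) := by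
  classical
  have hempty : ∅ ∉ subtreesIn G Q w := by simp [mem_subtreesIn]
  have hrhs : ∀ A, f A + ∑ B ∈ subtreesIn G Q w, f (A ∪ B) =
      ∑ B ∈ insert ∅ (subtreesIn G Q w), f (A ∪ B) := by
    intro A
    rw [sum_insert hempty, union_empty]
  simp_rw [hrhs]
  rw [← sum_product']
  have hsub : ∀ {A B : Finset V}, A ∈ subtreesIn G P v → B ∈ insert ∅ (subtreesIn G Q w) →
      (∀ x ∈ A, x ∈ P) ∧ (∀ x ∈ B, x ∈ Q) := by
    intro A B hA hB
    refine ⟨fun x hx => (mem_subtreesIn.1 hA).2.1 hx, fun x hx => ?_⟩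
    rcases mem_insert.1 hB with rfl | hB
    · simp at hx
    · exact (mem_subtreesIn.1 hB).2.1 hx
  have hPQ : ∀ x ∈ P, x ∉ Q := fun _ hx => Set.disjoint_left.1 h.disjoint hx
  symm
  refine sum_nbij' (fun p => p.1 ∪ p.2)
    (fun A => (A.filter (· ∈ P), A.filter (· ∈ Q))) ?_ ?_ ?_ ?_ (fun _ _ => rfl)
  · rintro ⟨A, B⟩ hAB
    obtain ⟨hA, hB⟩ := mem_product.1 hAB
    obtain ⟨hAP, hBQ⟩ := hsub hA hB
    have hA' := mem_subtreesIn.1 hA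
    rw [mem_subtreesIn, coe_union]
    refine ⟨mem_union_left _ hA'.1, Set.union_subset_union hAP hBQ,
      (h.induce_connected_union_iff hAP hBQ hA'.1).2 ⟨hA'.2.2, ?_⟩⟩
    rcases mem_insert.1 hB with hB | hB
    · left
      simpa using hB
    · right
      exact ⟨(mem_subtreesIn.1 hB).1, (mem_subtreesIn.1 hB).2.2⟩
  · intro A hA
    obtain ⟨hvA, hAPQ, hAc⟩ := mem_subtreesIn.1 hA
    have hunion : (A : Set V) =
        ((A.filter (· ∈ P) : Finset V) : Set V) ∪ ((A.filter (· ∈ Q) : Finset V) : Set V) := by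
      ext x
      have : x ∈ A → x ∈ P ∨ x ∈ Q := fun hx => hAPQ hx
      simp
      tauto
    rw [hunion, h.induce_connected_union_iff (by intro; simp +contextual) (by intro; simp +contextual)
      (by simp [hvA, h.left_mem])] at hAc
    refine mem_product.2 ⟨mem_subtreesIn.2 ⟨by simp [hvA, h.left_mem], by intro; simp +contextual, hAc.1⟩,
      mem_insert.2 ?_⟩
    refine hAc.2.imp (fun h => by exact_mod_cast h) fun h => mem_subtreesIn.2 ⟨h.1, ?_, h.2⟩
    intro
    simp +contextual
  · rintro ⟨A, B⟩ hAB
    obtain ⟨hA, hB⟩ := mem_product.1 hAB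
    obtain ⟨hAP, hBQ⟩ := hsub hA hB
    ext x
    · have := hAP x
      have := hBQ x
      have := hPQ x
      simp
      tauto
    · have := hAP x
      have := hBQ x
      have := hPQ x
      simp
      tauto
  · intro A hA
    ext x
    have : x ∈ A → x ∈ P ∨ x ∈ Q := fun hx => (mem_subtreesIn.1 hA).2.1 hx
    simp
    tauto

/-- The number of subtrees of `G` inside `S` containing `w`. -/
noncomputable def numSubtreesIn (G : SimpleGraph V) (S : Set V) (w : V) : ℝ :=
  (subtreesIn G S w).card

/-- The total order of the subtrees of `G` inside `S` containing `w`. -/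
noncomputable def totalOrderIn (G : SimpleGraph V) (S : Set V) (w : V) : ℝ :=
  ∑ A ∈ subtreesIn G S w, (A.card : ℝ)

/-- The average order of the subtrees of `G` inside `S` containing `w`. -/
noncomputable def meanOrderIn (G : SimpleGraph V) (S : Set V) (w : V) : ℝ :=
  totalOrderIn G S w / numSubtreesIn G S w

theorem one_le_numSubtreesIn {S : Set V} {w : V} (hw : w ∈ S) : 1 ≤ numSubtreesIn G S w := by
  unfold numSubtreesIn
  exact_mod_cast card_pos.2 ⟨_, singleton_mem_subtreesIn hw⟩

theorem one_le_meanOrderIn {S : Set V} {w : V} (hw : w ∈ S) : 1 ≤ meanOrderIn G S w := by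
  have h1 := one_le_numSubtreesIn (G := G) hw
  rw [meanOrderIn, one_le_div (by linarith), numSubtreesIn, totalOrderIn, card_eq_sum_ones]
  push_cast
  refine sum_le_sum fun A hA => ?_
  exact_mod_cast card_pos.2 ⟨w, (mem_subtreesIn.1 hA).1⟩

namespace IsBridgeBetween

variable {P Q : Set V} {v w : V}

theorem numSubtreesIn_union (h : IsBridgeBetween G P Q v w) :
    numSubtreesIn G (P ∪ Q) v = numSubtreesIn G P v * (1 + numSubtreesIn G Q w) := by
  have := h.sum_subtreesIn_union fun _ => 1
  simpa [numSubtreesIn, mul_add] using this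

theorem totalOrderIn_union (h : IsBridgeBetween G P Q v w) :
    totalOrderIn G (P ∪ Q) v = totalOrderIn G P v * (1 + numSubtreesIn G Q w) +
      numSubtreesIn G P v * totalOrderIn G Q w := by
  have hcard : ∀ A ∈ subtreesIn G P v, ∀ B ∈ subtreesIn G Q w,
      ((A ∪ B).card : ℝ) = A.card + B.card := by
    intro A hA B hB
    rw [card_union_of_disjoint, Nat.cast_add]
    rw [← disjoint_coe]
    exact h.disjoint.mono (mem_subtreesIn.1 hA).2.1 (mem_subtreesIn.1 hB).2.1
  simp only [totalOrderIn, numSubtreesIn]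
  rw [h.sum_subtreesIn_union fun A => (A.card : ℝ)]
  rw [sum_congr rfl fun A hA => by rw [sum_congr rfl (hcard A hA)]]
  simp only [sum_add_distrib, sum_const, nsmul_eq_mul, ← mul_sum]
  ring

theorem meanOrderIn_union (h : IsBridgeBetween G P Q v w) :
    meanOrderIn G (P ∪ Q) v = meanOrderIn G P v +
      numSubtreesIn G Q w * (meanOrderIn G Q w / (1 + numSubtreesIn G Q w)) := by
  have hP := one_le_numSubtreesIn (G := G) h.left_mem
  have hQ := one_le_numSubtreesIn (G := G) h.right_mem
  rw [meanOrderIn, meanOrderIn, meanOrderIn, h.numSubtreesIn_union, h.totalOrderIn_union]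
  field_simp

theorem div_le_div_of_meanOrderIn_le (h : IsBridgeBetween G P Q v w)
    (hle : meanOrderIn G (P ∪ Q) w ≤ meanOrderIn G (P ∪ Q) v) :
    meanOrderIn G Q w / (1 + numSubtreesIn G Q w) ≤
      meanOrderIn G P v / (1 + numSubtreesIn G P v) := by
  have hP := one_le_numSubtreesIn (G := G) h.left_mem
  have hQ := one_le_numSubtreesIn (G := G) h.right_mem
  rw [h.meanOrderIn_union, Set.union_comm, h.symm.meanOrderIn_union] at hle
  have e : ∀ a n : ℝ, 1 ≤ n → n * (a / (1 + n)) = a - a / (1 + n) := by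
    intro a n hn
    field_simp
    ring
  rw [e _ _ hP, e _ _ hQ] at hle
  linarith

end IsBridgeBetween

theorem subtreesIn_starBranches_empty (v : V) :
    subtreesIn G (starBranches G v ∅) v = {{v}} := by
  have hS : starBranches G v ∅ = {v} := by simp [starBranches]
  rw [hS]
  ext A
  rw [mem_singleton]
  constructor
  · intro hA
    obtain ⟨hv, hsub, _⟩ := mem_subtreesIn.1 hA
    exact (eq_singleton_iff_unique_mem).2 ⟨hv, fun x hx => hsub hx⟩
  · rintro rfl
    exact singleton_mem_subtreesIn rfl

theorem SimpleGraph.IsTree.numSubtreesIn_starBranches (hG : G.IsTree) {v : V} (W : Finset V)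
    (hW : ∀ w ∈ W, G.Adj v w) :
    numSubtreesIn G (starBranches G v W) v =
      ∏ w ∈ W, (1 + numSubtreesIn G (compDel G {v} w) w) := by
  induction W using Finset.induction_on with
  | empty => simp [numSubtreesIn, subtreesIn_starBranches_empty]
  | insert w W hw ih =>
    have hW' : ∀ x ∈ W, G.Adj v x := fun x hx => hW x (mem_insert_of_mem hx)
    have hb := hG.isBridgeBetween_starBranches (hW w (mem_insert_self _ _)) (W := (W : Set V))
      hW' (by simpa using hw)
    rw [coe_insert, starBranches_insert, hb.numSubtreesIn_union, ih hW', prod_insert hw, mul_comm]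

theorem SimpleGraph.IsTree.meanOrderIn_starBranches (hG : G.IsTree) {v : V} (W : Finset V)
    (hW : ∀ w ∈ W, G.Adj v w) :
    meanOrderIn G (starBranches G v W) v =
      1 + ∑ w ∈ W, numSubtreesIn G (compDel G {v} w) w *
        (meanOrderIn G (compDel G {v} w) w / (1 + numSubtreesIn G (compDel G {v} w) w)) := by
  induction W using Finset.induction_on with
  | empty => simp [meanOrderIn, totalOrderIn, numSubtreesIn, subtreesIn_starBranches_empty]
  | insert w W hw ih =>
    have hW' : ∀ x ∈ W, G.Adj v x := fun x hx => hW x (mem_insert_of_mem hx)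
    have hb := hG.isBridgeBetween_starBranches (hW w (mem_insert_self _ _)) (W := (W : Set V))
      hW' (by simpa using hw)
    rw [coe_insert, starBranches_insert, hb.meanOrderIn_union, ih hW', sum_insert hw]
    ring

/-- A vertex of a tree whose local mean subtree order is at least that of each of its neighbours
has degree at most `2`. -/
theorem SimpleGraph.IsTree.ncard_neighborSet_le_two (hG : G.IsTree) {v : V}
    (hmax : ∀ w, G.Adj v w → meanOrder G w ≤ meanOrder G v) :
    (G.neighborSet v).ncard ≤ 2 := by
  classical
  by_contra! hdeg
  have hmean : ∀ w, meanOrder G w = meanOrderIn G Set.univ w := fun _ => rfl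
  rw [Set.ncard_eq_toFinset_card'] at hdeg
  set N := (G.neighborSet v).toFinset
  have hN : ∀ w ∈ N, G.Adj v w := fun w hw => by simpa [N] using hw
  set n : V → ℝ := fun w => numSubtreesIn G (compDel G {v} w) w
  set m : V → ℝ := fun w => meanOrderIn G (compDel G {v} w) w
  have hn : ∀ w ∈ N, 1 ≤ n w := fun w hw => one_le_numSubtreesIn (mem_compDel_self (hN w hw).ne')
  have hm : ∀ w ∈ N, 1 ≤ m w := fun w hw => one_le_meanOrderIn (mem_compDel_self (hN w hw).ne')
  obtain ⟨u, hu, humax⟩ := exists_max_image N (fun w => m w / (1 + n w))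
    (card_pos.1 (by omega))
  have hW : ∀ w ∈ N.erase u, G.Adj v w := fun w hw => hN w (mem_of_mem_erase hw)
  have hb := hG.isBridgeBetween_starBranches (hN u hu) (W := (N.erase u : Set V))
    (fun w hw => hW w (mem_coe.1 hw)) (by simp)
  have huniv : starBranches G v (N.erase u : Set V) ∪ compDel G {v} u = Set.univ := by
    rw [← starBranches_insert, ← coe_insert, insert_erase hu, Set.coe_toFinset,
      hG.connected.starBranches_neighborSet]
  have hineq := hb.div_le_div_of_meanOrderIn_le (by rw [huniv]; exact hmax u (hN u hu))
  rw [hG.numSubtreesIn_starBranches _ hW, hG.meanOrderIn_starBranches _ hW] at hineq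
  obtain ⟨b, hbW, c, hcW, hbc⟩ := one_lt_card.1
    (by rw [card_erase_of_mem hu]; omega : 1 < (N.erase u).card)
  have hbN := mem_of_mem_erase hbW
  have hcW' : c ∈ (N.erase u).erase b := mem_erase.2 ⟨hbc.symm, hcW⟩
  set f := m u / (1 + n u)
  set s := ∑ w ∈ (N.erase u).erase b, n w
  have hmem : ∀ w ∈ (N.erase u).erase b, w ∈ N :=
    fun w hw => mem_of_mem_erase (mem_of_mem_erase hw)
  have hs : 1 ≤ s := (hn c (hmem c hcW')).trans
    (single_le_sum (fun w hw => by linarith [hn w (hmem w hw)]) hcW')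
  have hprod : (1 + n b) * (1 + s) ≤ ∏ w ∈ N.erase u, (1 + n w) := by
    rw [← mul_prod_erase _ _ hbW]
    refine mul_le_mul_of_nonneg_left ?_ (by linarith [hn b hbN])
    exact one_add_sum_le_prod_one_add_of_nonneg fun w hw => by linarith [hn w (hmem w hw)]
  have hsum : ∑ w ∈ N.erase u, n w * (m w / (1 + n w)) ≤ (n b + s) * f := by
    rw [add_sum_erase _ _ hbW, sum_mul]
    refine sum_le_sum fun w hw => ?_
    have hwN := mem_of_mem_erase hw
    exact mul_le_mul_of_nonneg_left (humax w hwN) (by linarith [hn w hwN])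
  have hfb : 1 ≤ f * (1 + n b) := by
    have h1 : m b / (1 + n b) ≤ f := humax b hbN
    rw [div_le_iff₀ (by linarith [hn b hbN])] at h1
    exact (hm b hbN).trans h1
  have hnb := hn b hbN
  have hf : 0 < f := by
    by_contra! hf
    nlinarith
  rw [le_div_iff₀ (by nlinarith)] at hineq
  have h2 : f * (1 + (1 + n b) * (1 + s)) ≤ 1 + (n b + s) * f := by
    refine (mul_le_mul_of_nonneg_left ?_ hf.le).trans (hineq.trans ?_)
    · linarith
    · linarith
  have h3 : f * n b ≤ f * n b * s := le_mul_of_one_le_right (by positivity) hs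
  nlinarith

end Counting

/-- The maximum local mean subtree order of a finite tree is attained at a
vertex of degree at most `2` (a leaf or a vertex of degree `2`). -/
theorem max_meanOrder_at_small_degree {V : Type*} [Fintype V] [DecidableEq V] [Nonempty V]
    (G : SimpleGraph V) (hG : G.IsTree) :
    ∃ u : V, (G.neighborSet u).ncard ≤ 2 ∧ ∀ w : V, meanOrder G w ≤ meanOrder G u := by
  obtain ⟨u, hu⟩ := Finite.exists_max (meanOrder G)
  exact ⟨u, hG.ncard_neighborSet_le_two fun w _ => hu w, hu⟩
end

section
/- Let T be a nontrivial k-tree and C a k-clique of T. Then there is a bijection between the set of sub-k-trees of T containing C and the set of subtrees of the characteristic 1-tree T'_C containing the vertex C, under which a sub-k-tree of order m corresponds to a subtree of order m − k + 1. -/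
open Finset Polynomial

variable {V : Type*}

/-- `IsKTreeOn G k s` : the induced subgraph of `G` on the vertex set `s` is a `k`-tree,
following the recursive definition: `K_k` is a `k`-tree, and a `k`-tree grows by adding a
new vertex adjacent exactly to the vertices of some `k`-clique. -/
inductive IsKTreeOn [DecidableEq V] (G : SimpleGraph V) (k : ℕ) : Finset V → Prop
  | base (s : Finset V) : G.IsNClique k s → IsKTreeOn G k s
  | grow (s : Finset V) (v : V) (C : Finset V) :
      IsKTreeOn G k s → v ∉ s → C ⊆ s → G.IsNClique k C →
      (∀ w ∈ s, G.Adj v w ↔ w ∈ C) → IsKTreeOn G k (insert v s)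

/-- `G` is a `k`-tree. -/
def IsKTree [Fintype V] [DecidableEq V] (G : SimpleGraph V) (k : ℕ) : Prop :=
  IsKTreeOn G k Finset.univ

/-- The vertex sets of the sub-`k`-trees of `G` containing the `k`-clique `C`. -/
noncomputable def subKTrees [Fintype V] [DecidableEq V] (G : SimpleGraph V) (k : ℕ)
    (C : Finset V) : Finset (Finset V) := by
  classical
  exact Finset.univ.filter fun A => C ⊆ A ∧ IsKTreeOn G k A

/-- The local mean order `μ(T; C)`: the average order of the sub-`k`-trees of `G`
containing the `k`-clique `C`. -/
noncomputable def kMean [Fintype V] [DecidableEq V] (G : SimpleGraph V) (k : ℕ)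
    (C : Finset V) : ℝ :=
  (∑ A ∈ subKTrees G k C, (A.card : ℝ)) / ((subKTrees G k C).card : ℝ)

/-- The degree of a `k`-clique `C` in `G`: the number of `(k+1)`-cliques of `G`
containing `C`. -/
noncomputable def cliqueDeg [Fintype V] [DecidableEq V] (G : SimpleGraph V) (k : ℕ)
    (C : Finset V) : ℕ := by
  classical
  exact (Finset.univ.filter fun Q : Finset V => C ⊆ Q ∧ G.IsNClique (k + 1) Q).card

/-- Two (distinct) `k`-cliques are adjacent if they are contained in a common
`(k+1)`-clique. -/
def CliqueAdj (G : SimpleGraph V) (k : ℕ) (C₁ C₂ : Finset V) : Prop :=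
  C₁ ≠ C₂ ∧ ∃ Q : Finset V, G.IsNClique (k + 1) Q ∧ C₁ ⊆ Q ∧ C₂ ⊆ Q

/-- `IsPathTypeOn G k s` : the induced subgraph of `G` on `s` is a path-type `k`-tree:
`K_k` and `K_{k+1}` are path-type, and a path-type `k`-tree of order `≥ k+1` grows by
joining a new vertex to a simplicial `k`-clique (a `k`-clique containing a vertex of
degree `k`). -/
inductive IsPathTypeOn [DecidableEq V] (G : SimpleGraph V) (k : ℕ) : Finset V → Prop
  | base₁ (s : Finset V) : G.IsNClique k s → IsPathTypeOn G k s
  | base₂ (s : Finset V) : G.IsNClique (k + 1) s → IsPathTypeOn G k s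
  | grow (s : Finset V) (v : V) (C : Finset V) :
      IsPathTypeOn G k s → k + 1 ≤ s.card → v ∉ s → C ⊆ s → G.IsNClique k C →
      (∃ ℓ ∈ C, (G.neighborSet ℓ ∩ (↑s : Set V)).ncard = k) →
      (∀ w ∈ s, G.Adj v w ↔ w ∈ C) → IsPathTypeOn G k (insert v s)

/-- `IsPEO G k C L` : the reverse of the list `L = [w₁, …, w_s, v]` is a perfect
elimination ordering of the induced subgraph on `C ∪ L` down to `C`: each vertex, from
the last one backwards, is a `k`-leaf (degree exactly `k`) of the graph induced on `C`
together with the not-yet-eliminated vertices. -/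
inductive IsPEO [DecidableEq V] (G : SimpleGraph V) (k : ℕ) (C : Finset V) : List V → Prop
  | nil : IsPEO G k C []
  | snoc (l : List V) (v : V) : IsPEO G k C l → v ∉ C → v ∉ l →
      (G.neighborSet v ∩ ((↑C : Set V) ∪ {x | x ∈ l})).ncard = k →
      IsPEO G k C (l ++ [v])

/-- `IsCanonPath G k C L` : the list `L = [w₁, …, w_s, v]` records the unique sequence
`A_T(C, v)` of Stephens–Oellermann: the induced subgraph on `C ∪ L` is a path-type
`k`-tree having `C` as a simplicial `k`-clique, and `(v, w_s, …, w₁)` is a perfect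
elimination ordering of it down to `C`. -/
def IsCanonPath [Fintype V] [DecidableEq V] (G : SimpleGraph V) (k : ℕ) (C : Finset V)
    (L : List V) : Prop :=
  L ≠ [] ∧ L.Nodup ∧ (∀ x ∈ L, x ∉ C) ∧
    IsPathTypeOn G k (C ∪ L.toFinset) ∧
    (∃ ℓ ∈ C, (G.neighborSet ℓ ∩ ((↑C : Set V) ∪ {x | x ∈ L})).ncard = k) ∧
    IsPEO G k C L

/-- The characteristic `1`-tree `T'_C` of the `k`-tree `G` with respect to the `k`-clique
`C`.  Its vertices are the vertices of `G` outside `C` together with one extra vertex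
`none` representing `C`; its edges are the union, over all `k`-leaves `v` of `G` outside
`C`, of the paths `C – w₁ – ⋯ – w_s – v` given by the canonical sequences `A_T(C, v)`. -/
def charTree [Fintype V] [DecidableEq V] (G : SimpleGraph V) (k : ℕ) (C : Finset V) :
    SimpleGraph (Option {x : V // x ∉ C}) :=
  SimpleGraph.fromRel fun a b =>
    ∃ L : List V, IsCanonPath G k C L ∧
      (∃ v, L.getLast? = some v ∧ (G.neighborSet v).ncard = k) ∧
      ((a = none ∧ ∃ y : {x : V // x ∉ C}, b = some y ∧ L.head? = some y.val) ∨
        (∃ x y : {x : V // x ∉ C}, a = some x ∧ b = some y ∧ [x.val, y.val] <:+: L))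

/-- `GrowsFrom G k C s` : the induced subgraph on `s` is obtained from the clique `C` by
successively adding vertices joined to `k`-cliques. -/
inductive GrowsFrom [DecidableEq V] (G : SimpleGraph V) (k : ℕ) (C : Finset V) :
    Finset V → Prop
  | base : GrowsFrom G k C C
  | grow (s : Finset V) (v : V) (D : Finset V) :
      GrowsFrom G k C s → v ∉ s → D ⊆ s → G.IsNClique k D →
      (∀ w ∈ s, G.Adj v w ↔ w ∈ D) → GrowsFrom G k C (insert v s)

section Growth

variable [DecidableEq V] {G : SimpleGraph V} {k : ℕ} {C : Finset V}

theorem GrowsFrom.subset {s : Finset V} (h : GrowsFrom G k C s) : C ⊆ s := by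
  induction h with
  | base => exact Subset.rfl
  | grow s v D _ _ _ _ _ ih => exact ih.trans (subset_insert _ _)

/-- Exchange step: a growth from the neighbourhood `D` of a new vertex `v` becomes a growth
from the clique obtained by replacing `d ∈ D` by `v`. -/
theorem GrowsFrom.exchange {D s : Finset V} {v d : V} (h : GrowsFrom G k D s)
    (hv : v ∉ s) (hadj : ∀ w ∈ s, G.Adj v w ↔ w ∈ D) (hd : d ∈ D)
    (hD : G.IsClique (D : Set V)) (hC : G.IsNClique k (insert v (D.erase d))) :
    GrowsFrom G k (insert v (D.erase d)) (insert v s) := by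
  induction h with
  | base =>
    have e : insert v D = insert d (insert v (D.erase d)) := by
      rw [Finset.insert_comm, insert_erase hd]
    rw [e]
    refine .grow _ _ _ .base ?_ Subset.rfl hC ?_
    · have : d ≠ v := fun h => hv (h ▸ hd)
      simp [this]
    · intro w hw
      refine ⟨fun _ => hw, fun _ => ?_⟩
      rcases mem_insert.1 hw with rfl | hw
      · exact ((hadj d hd).2 hd).symm
      · exact hD hd (mem_of_mem_erase hw) (ne_of_mem_erase hw).symm
  | grow s w E hs hw hE hEc hwE ih =>
    have hvs : v ∉ s := fun h => hv (mem_insert_of_mem h)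
    have hvw : v ≠ w := fun h => hv (h ▸ mem_insert_self _ _)
    rw [Finset.insert_comm]
    refine .grow _ _ E (ih hvs fun u hu => hadj u (mem_insert_of_mem hu)) ?_
      (hE.trans (subset_insert _ _)) hEc ?_
    · simp [hvw.symm, hw]
    · intro u hu
      rcases mem_insert.1 hu with rfl | hu
      · have h1 : ¬ G.Adj w u := fun h =>
          hw (hs.subset ((hadj w (mem_insert_self _ _)).1 h.symm))
        exact iff_of_false h1 fun h => hvs (hE h)
      · exact hwE u hu

/-- A `k`-tree can be grown from any of its `k`-cliques. -/
theorem IsKTreeOn.growsFrom {s : Finset V} (h : IsKTreeOn G k s) (hC : G.IsNClique k C)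
    (hCs : C ⊆ s) : GrowsFrom G k C s := by
  induction h generalizing C with
  | base s hs =>
    rw [eq_of_subset_of_card_le hCs (by rw [hs.card_eq, hC.card_eq])]
    exact .base
  | grow s v D _ hv hD hDc hadj ih =>
    by_cases hvC : v ∈ C
    · have hsub : C.erase v ⊆ D := by
        intro w hw
        have hwC := mem_of_mem_erase hw
        have hne := ne_of_mem_erase hw
        have hws := (mem_insert.1 (hCs hwC)).resolve_left hne
        exact (hadj w hws).1 (hC.isClique hvC hwC hne.symm)
      have hcard := card_erase_add_one hvC
      have h1 := hC.card_eq
      have h2 := hDc.card_eq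
      obtain ⟨d, hdD, hd⟩ : ∃ d ∈ D, d ∉ C.erase v :=
        exists_mem_notMem_of_card_lt_card (by omega)
      have hde : C.erase v = D.erase d := by
        apply eq_of_subset_of_card_le
        · intro w hw
          exact mem_erase.2 ⟨fun h => hd (h ▸ hw), hsub hw⟩
        · have := card_erase_add_one hdD
          omega
      have hCe : C = insert v (D.erase d) := by rw [← hde, insert_erase hvC]
      rw [hCe] at hC ⊢
      exact (ih hDc hD).exchange hv hadj hdD hDc.isClique hC
    · have : C ⊆ s := fun w hw =>
        (mem_insert.1 (hCs hw)).resolve_left fun h => hvC (h ▸ hw)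
      exact .grow s v D (ih hC this) hv hD hDc hadj

theorem IsPathTypeOn.isKTreeOn {s : Finset V} (h : IsPathTypeOn G k s) :
    IsKTreeOn G k s := by
  induction h with
  | base₁ s hs => exact .base s hs
  | base₂ s hs =>
    obtain ⟨v, hv⟩ : s.Nonempty := card_pos.1 (by rw [hs.card_eq]; omega)
    have hcl : G.IsNClique k (s.erase v) :=
      ⟨hs.isClique.subset (by simp), by rw [card_erase_of_mem hv, hs.card_eq]; rfl⟩
    rw [← insert_erase hv]
    refine .grow _ v _ (.base _ hcl) (notMem_erase _ _) Subset.rfl hcl fun w hw => ?_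
    exact ⟨fun _ => hw, fun _ =>
      hs.isClique hv (mem_of_mem_erase hw) (ne_of_mem_erase hw).symm⟩
  | grow s v D _ _ hv hD hDc _ hadj ih => exact .grow s v D ih hv hD hDc hadj

theorem ncard_neighborSet_inter_insert {s : Finset V} {v x : V} (hv : v ∉ s)
    (hxv : G.Adj v x) :
    (G.neighborSet x ∩ (↑(insert v s) : Set V)).ncard =
      (G.neighborSet x ∩ (s : Set V)).ncard + 1 := by
  rw [coe_insert, Set.inter_insert_of_mem (by simpa using hxv.symm),
    Set.ncard_insert_of_notMem (fun h => hv h.2) (s.finite_toSet.inter_of_right _)]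

theorem ncard_neighborSet_inter_le {s : Finset V} {v x : V} :
    (G.neighborSet x ∩ (s : Set V)).ncard ≤
      (G.neighborSet x ∩ (↑(insert v s) : Set V)).ncard :=
  Set.ncard_le_ncard (Set.inter_subset_inter_right _ (by simp))
    ((insert v s).finite_toSet.inter_of_right _)

/-- Every vertex of a `k`-tree other than `K_k` has degree at least `k`. -/
theorem IsKTreeOn.le_degree {s : Finset V} (h : IsKTreeOn G k s) (hs : k + 1 ≤ s.card)
    {x : V} (hx : x ∈ s) : k ≤ (G.neighborSet x ∩ (s : Set V)).ncard := by
  induction h with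
  | base s h => rw [h.card_eq] at hs; omega
  | grow s v D hk hv hD hDc hadj ih =>
    rcases mem_insert.1 hx with rfl | hxs
    · rw [← hDc.card_eq, ← Set.ncard_coe_finset]
      refine Set.ncard_le_ncard (fun w hw => ?_) (Finset.finite_toSet _ |>.inter_of_right _)
      exact ⟨(hadj w (hD hw)).2 hw, by simp [hD hw]⟩
    · by_cases hc : k + 1 ≤ s.card
      · exact (ih hc hxs).trans ncard_neighborSet_inter_le
      · have hDs : D = s := eq_of_subset_of_card_le hD (by rw [hDc.card_eq]; omega)
        subst hDs
        rw [ncard_neighborSet_inter_insert hv ((hadj x hxs).2 hxs)]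
        have : (D.erase x).card ≤ (G.neighborSet x ∩ (D : Set V)).ncard := by
          rw [← Set.ncard_coe_finset]
          refine Set.ncard_le_ncard (fun w hw => ?_) (D.finite_toSet.inter_of_right _)
          have hw := mem_erase.1 (mem_coe.1 hw)
          exact ⟨hDc.isClique hxs hw.2 hw.1.symm, hw.2⟩
        rw [card_erase_of_mem hxs, hDc.card_eq] at this
        omega

/-- A path-type `k`-tree of order at least `k + 2` has at most two `k`-leaves. -/
theorem IsPathTypeOn.exists_leaf_pair {s : Finset V} (h : IsPathTypeOn G k s)
    (hs : k + 2 ≤ s.card) :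
    ∃ T : Finset V, T.card ≤ 2 ∧
      ∀ x ∈ s, (G.neighborSet x ∩ (s : Set V)).ncard = k → x ∈ T := by
  induction h with
  | base₁ s h => rw [h.card_eq] at hs; omega
  | base₂ s h => rw [h.card_eq] at hs; omega
  | grow s v D hp hs1 hv hD hDc hl hadj ih =>
    have hdeg : ∀ x ∈ s, k ≤ (G.neighborSet x ∩ (s : Set V)).ncard :=
      fun x hx => hp.isKTreeOn.le_degree hs1 hx
    have hnot : ∀ x ∈ D, (G.neighborSet x ∩ (↑(insert v s) : Set V)).ncard ≠ k := by
      intro x hx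
      rw [ncard_neighborSet_inter_insert hv ((hadj x (hD hx)).2 hx)]
      have := hdeg x (hD hx)
      omega
    rcases Nat.lt_or_ge s.card (k + 2) with hc | hc
    · refine ⟨insert v (s \ D), ?_, ?_⟩
      · have := card_insert_le v (s \ D)
        rw [card_sdiff_of_subset hD, hDc.card_eq] at this
        omega
      · intro x hx hxk
        rcases mem_insert.1 hx with rfl | hxs
        · exact mem_insert_self _ _
        · exact mem_insert_of_mem (mem_sdiff.2 ⟨hxs, fun h => hnot x h hxk⟩)
    · obtain ⟨T, hT, hTl⟩ := ih hc
      obtain ⟨l, hlD, hlk⟩ := hl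
      refine ⟨insert v (T.erase l), ?_, ?_⟩
      · have := card_insert_le v (T.erase l)
        rw [card_erase_of_mem (hTl l (hD hlD) hlk)] at this
        have : 0 < T.card := card_pos.2 ⟨l, hTl l (hD hlD) hlk⟩
        omega
      · intro x hx hxk
        rcases mem_insert.1 hx with rfl | hxs
        · exact mem_insert_self _ _
        · refine mem_insert_of_mem (mem_erase.2 ⟨fun h => hnot x (h ▸ hlD) hxk, hTl x hxs ?_⟩)
          have h1 := hdeg x hxs
          have h2 := ncard_neighborSet_inter_le (G := G) (s := s) (v := v) (x := x)
          omega

theorem GrowsFrom.exists_rank {s : Finset V} (h : GrowsFrom G k C s) :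
    ∃ r : V → ℕ, (∀ x ∈ s, r x = 0 ↔ x ∈ C) ∧
      (∀ x ∈ s, ∀ y ∈ s, r x = r y → x = y ∨ x ∈ C) ∧
      ∀ x ∈ s, x ∉ C → ∃ D ⊆ s, G.IsNClique k D ∧
        ∀ y ∈ s, (G.Adj x y ∧ r y < r x) ↔ y ∈ D := by
  induction h with
  | base => exact ⟨fun _ => 0, by simp, fun x hx _ _ _ => .inr hx, fun x hx h => (h hx).elim⟩
  | grow s v D hs hv hD hDc hadj ih =>
    obtain ⟨r, h0, hinj, hcl⟩ := ih
    have hvC : v ∉ C := fun h => hv (hs.subset h)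
    let r' : V → ℕ := fun x => if x = v then s.sup r + 1 else r x
    have hr'v : r' v = s.sup r + 1 := by simp [r']
    have hr' : ∀ x ∈ s, r' x = r x := fun x hx => by
      have : x ≠ v := fun h => hv (h ▸ hx)
      simp [r', this]
    have hlt : ∀ x ∈ s, r x < s.sup r + 1 := fun x hx => Nat.lt_succ_of_le (le_sup hx)
    refine ⟨r', ?_, ?_, ?_⟩
    · intro x hx
      rcases mem_insert.1 hx with rfl | hx
      · simp [hr'v, hvC]
      · rw [hr' x hx, h0 x hx]
    · intro x hx y hy hxy
      rcases mem_insert.1 hx with hxv | hxs <;> rcases mem_insert.1 hy with hyv | hys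
      · exact .inl (hxv.trans hyv.symm)
      · rw [hxv, hr'v, hr' y hys] at hxy
        exact absurd hxy (hlt y hys).ne'
      · rw [hyv, hr'v, hr' x hxs] at hxy
        exact absurd hxy (hlt x hxs).ne
      · rw [hr' x hxs, hr' y hys] at hxy
        exact hinj x hxs y hys hxy
    · intro x hx hxC
      rcases mem_insert.1 hx with rfl | hx
      · refine ⟨D, hD.trans (subset_insert _ _), hDc, fun y hy => ?_⟩
        rcases mem_insert.1 hy with rfl | hy
        · simpa using fun h => hv (hD h)
        · rw [hr'v, hr' y hy, hadj y hy]
          simp [hlt y hy]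
      · obtain ⟨E, hE, hEc, hEm⟩ := hcl x hx hxC
        refine ⟨E, hE.trans (subset_insert _ _), hEc, fun y hy => ?_⟩
        rcases mem_insert.1 hy with hyv | hys
        · rw [hyv, hr'v, hr' x hx]
          exact iff_of_false (fun h => (hlt x hx).not_gt h.2) fun h => hv (hE h)
        · rw [hr' x hx, hr' y hys]
          exact hEm y hys

end Growth

/-- The neighbours of `x` of smaller rank. -/
noncomputable def backNbrs [Fintype V] (G : SimpleGraph V) (r : V → ℕ) (x : V) : Finset V := by
  classical
  exact Finset.univ.filter fun y => G.Adj x y ∧ r y < r x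

/-- `r` ranks the vertices of `G` by a growth order of `G` from the clique `C`. -/
structure IsGrowthRank [Fintype V] (G : SimpleGraph V) (k : ℕ) (C : Finset V) (r : V → ℕ) :
    Prop where
  eq_zero_iff : ∀ x, r x = 0 ↔ x ∈ C
  eq_or_mem : ∀ x y, r x = r y → x = y ∨ x ∈ C
  isNClique : ∀ x, x ∉ C → G.IsNClique k (backNbrs G r x)

/-- `x` is the parent of `y` in the rooted tree defined by the growth rank `r`. -/
def IsParent [Fintype V] (G : SimpleGraph V) (C : Finset V) (r : V → ℕ) (x y : V) : Prop :=
  x ∉ C ∧ x ∈ backNbrs G r y ∧ ∀ z ∈ backNbrs G r y, z = x ∨ z ∈ backNbrs G r x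

/-- `IsBranch G C r l v` : `l` is the list of proper ancestors of `v`, from the root. -/
inductive IsBranch [Fintype V] (G : SimpleGraph V) (C : Finset V) (r : V → ℕ) :
    List V → V → Prop
  | root (v : V) : v ∉ C → backNbrs G r v ⊆ C → IsBranch G C r [] v
  | step (l : List V) (x v : V) :
      IsBranch G C r l x → v ∉ C → IsParent G C r x v → IsBranch G C r (l ++ [x]) v

section Rank

variable [Fintype V] {G : SimpleGraph V} {k : ℕ} {C : Finset V} {r : V → ℕ}

@[simp]
theorem mem_backNbrs {x y : V} : y ∈ backNbrs G r x ↔ G.Adj x y ∧ r y < r x := by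
  simp [backNbrs]

theorem GrowsFrom.exists_isGrowthRank [DecidableEq V] (h : GrowsFrom G k C Finset.univ) :
    ∃ r, IsGrowthRank G k C r := by
  obtain ⟨r, h0, hinj, hcl⟩ := h.exists_rank
  refine ⟨r, fun x => h0 x (mem_univ _), fun x y => hinj x (mem_univ _) y (mem_univ _),
    fun x hx => ?_⟩
  obtain ⟨D, -, hD, hm⟩ := hcl x (mem_univ _) hx
  have : backNbrs G r x = D := by
    ext y
    rw [mem_backNbrs, hm y (mem_univ _)]
  rwa [this]

namespace IsGrowthRank

theorem mem_or_mem (hr : IsGrowthRank G k C r) {x y : V} (h : G.Adj x y) (hx : x ∉ C) :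
    x ∈ backNbrs G r y ∨ y ∈ backNbrs G r x := by
  rcases lt_trichotomy (r x) (r y) with hlt | heq | hlt
  · exact .inl (mem_backNbrs.2 ⟨h.symm, hlt⟩)
  · exact ((hr.eq_or_mem x y heq).elim h.ne hx).elim
  · exact .inr (mem_backNbrs.2 ⟨h, hlt⟩)

theorem notMem_of_mem_backNbrs (hr : IsGrowthRank G k C r) {x y : V}
    (h : x ∈ backNbrs G r y) : y ∉ C := fun hy => by
  have := (mem_backNbrs.1 h).2
  rw [(hr.eq_zero_iff y).2 hy] at this
  omega

theorem adj_of_mem_backNbrs (hr : IsGrowthRank G k C r) {x y z : V}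
    (hx : x ∈ backNbrs G r z) (hy : y ∈ backNbrs G r z) (hne : x ≠ y) : G.Adj x y :=
  (hr.isNClique z (hr.notMem_of_mem_backNbrs hx)).isClique hx hy hne

/-- A vertex has a child for which it is the parent as soon as it has a later neighbour. -/
theorem exists_isParent (hr : IsGrowthRank G k C r) {x y : V} (hx : x ∉ C)
    (h : x ∈ backNbrs G r y) : ∃ z, IsParent G C r x z := by
  classical
  obtain ⟨z, hz, hmin⟩ := exists_min_image (Finset.univ.filter fun z => x ∈ backNbrs G r z) r
    ⟨y, by simpa using h⟩
  simp only [mem_filter, mem_univ, true_and] at hz hmin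
  refine ⟨z, hx, hz, fun u hu => or_iff_not_imp_left.2 fun hne => ?_⟩
  rcases hr.mem_or_mem (hr.adj_of_mem_backNbrs hz hu (Ne.symm hne)) hx with h | h
  · exact absurd (hmin u h) (mem_backNbrs.1 hu).2.not_ge
  · exact h

theorem exists_isParent_of_not_subset (hr : IsGrowthRank G k C r) {y : V}
    (h : ¬ backNbrs G r y ⊆ C) : ∃ x, IsParent G C r x y := by
  classical
  obtain ⟨u, hu, huC⟩ := not_subset.1 h
  obtain ⟨x, hx, hmax⟩ := exists_max_image (backNbrs G r y) r ⟨u, hu⟩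
  have hxC : x ∉ C := fun hxC => by
    have h1 := hmax u hu
    rw [(hr.eq_zero_iff x).2 hxC] at h1
    exact huC ((hr.eq_zero_iff u).1 (by omega))
  refine ⟨x, hxC, hx, fun z hz => or_iff_not_imp_left.2 fun hne => ?_⟩
  rcases hr.mem_or_mem (hr.adj_of_mem_backNbrs hx hz (Ne.symm hne)) hxC with h | h
  · exact absurd (hmax z hz) (mem_backNbrs.1 h).2.not_ge
  · exact h

theorem isParent_unique {x x' y : V} (h : IsParent G C r x y)
    (h' : IsParent G C r x' y) : x = x' := by
  by_contra hne
  have h1 := (h.2.2 x' h'.2.1).resolve_left (Ne.symm hne)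
  have h2 := (h'.2.2 x h.2.1).resolve_left hne
  exact (mem_backNbrs.1 h1).2.not_gt (mem_backNbrs.1 h2).2

theorem backNbrs_eq_of_subset (hr : IsGrowthRank G k C r) (hC : G.IsNClique k C) {y : V}
    (hy : y ∉ C) (h : backNbrs G r y ⊆ C) : backNbrs G r y = C :=
  eq_of_subset_of_card_le h (by rw [(hr.isNClique y hy).card_eq, hC.card_eq])

/-- Sub-`k`-trees containing `C` are closed under taking earlier neighbours. -/
theorem backNbrs_subset_of_growsFrom [DecidableEq V] (hr : IsGrowthRank G k C r) {s : Finset V}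
    (h : GrowsFrom G k C s) {x : V} (hx : x ∈ s) (hxC : x ∉ C) : backNbrs G r x ⊆ s := by
  induction h generalizing x with
  | base => exact (hxC hx).elim
  | grow s v D hs hv hD hDc hadj ih =>
    rcases mem_insert.1 hx with rfl | hx
    · have hDx : D ⊆ backNbrs G r x := fun d hd => by
        refine (hr.mem_or_mem ((hadj d (hD hd)).2 hd) hxC).resolve_left fun h => ?_
        exact hv (ih (hD hd) (hr.notMem_of_mem_backNbrs h) h)
      rw [← eq_of_subset_of_card_le hDx (by rw [(hr.isNClique x hxC).card_eq, hDc.card_eq])]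
      exact hD.trans (subset_insert _ _)
    · exact (ih hx hxC).trans (subset_insert _ _)

theorem isKTreeOn_of_closed [DecidableEq V] (hr : IsGrowthRank G k C r)
    (hC : G.IsNClique k C) {s : Finset V} (hCs : C ⊆ s)
    (h : ∀ x ∈ s, x ∉ C → backNbrs G r x ⊆ s) : IsKTreeOn G k s := by
  induction hn : s.card generalizing s with
  | zero =>
    rw [card_eq_zero] at hn
    subst hn
    rw [subset_empty] at hCs
    exact hCs ▸ .base _ hC
  | succ n ih =>
    by_cases hsC : s ⊆ C
    · rw [hsC.antisymm hCs]
      exact .base _ hC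
    · obtain ⟨u, hu, huC⟩ := not_subset.1 hsC
      obtain ⟨x, hx, hmax⟩ := exists_max_image s r ⟨u, hu⟩
      have hxC : x ∉ C := fun hxC => by
        have h1 := hmax u hu
        rw [(hr.eq_zero_iff x).2 hxC] at h1
        exact huC ((hr.eq_zero_iff u).1 (by omega))
      have hxs : backNbrs G r x ⊆ s.erase x := fun y hy =>
        mem_erase.2 ⟨(mem_backNbrs.1 hy).1.ne', h x hx hxC hy⟩
      rw [← insert_erase hx]
      refine .grow _ x _ (ih ?_ ?_ ?_) (notMem_erase _ _) hxs (hr.isNClique x hxC) ?_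
      · exact fun y hy => mem_erase.2 ⟨fun e => hxC (e ▸ hy), hCs hy⟩
      · refine fun y hy hyC z hz => mem_erase.2 ⟨?_, h y (mem_of_mem_erase hy) hyC hz⟩
        rintro rfl
        exact (hmax y (mem_of_mem_erase hy)).not_gt (mem_backNbrs.1 hz).2
      · rw [card_erase_of_mem hx, hn]
        rfl
      · intro w hw
        refine ⟨fun hxw => (hr.mem_or_mem hxw hxC).resolve_left fun hmem => ?_,
          fun hw => (mem_backNbrs.1 hw).1⟩
        exact (hmax w (mem_of_mem_erase hw)).not_gt (mem_backNbrs.1 hmem).2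

theorem isKTreeOn_iff [DecidableEq V] (hr : IsGrowthRank G k C r)
    (hC : G.IsNClique k C) {s : Finset V} (hCs : C ⊆ s) :
    IsKTreeOn G k s ↔ ∀ x ∈ s, x ∉ C → backNbrs G r x ⊆ s :=
  ⟨fun h _ => hr.backNbrs_subset_of_growsFrom (h.growsFrom hC hCs),
    hr.isKTreeOn_of_closed hC hCs⟩

theorem backNbrs_subset_iff_parent_mem (hr : IsGrowthRank G k C r) {s : Finset V}
    (hCs : C ⊆ s) :
    (∀ x ∈ s, x ∉ C → backNbrs G r x ⊆ s) ↔
      ∀ y ∈ s, ∀ x, IsParent G C r x y → x ∈ s := by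
  refine ⟨fun h y hy x hx => h y hy (hr.notMem_of_mem_backNbrs hx.2.1) hx.2.1, fun h => ?_⟩
  suffices H : ∀ n, ∀ y ∈ s, r y = n → backNbrs G r y ⊆ s from
    fun y hy _ => H _ y hy rfl
  intro n
  induction n using Nat.strong_induction_on with
  | _ n ih =>
    intro y hy hn
    by_cases hyC : backNbrs G r y ⊆ C
    · exact hyC.trans hCs
    · obtain ⟨x, hx⟩ := hr.exists_isParent_of_not_subset hyC
      have hxs := h y hy x hx
      intro z hz
      rcases hx.2.2 z hz with rfl | hz
      · exact hxs
      · exact ih (r x) (hn ▸ (mem_backNbrs.1 hx.2.1).2) x hxs rfl hz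

theorem exists_isBranch (hr : IsGrowthRank G k C r) {v : V} (hv : v ∉ C) :
    ∃ l, IsBranch G C r l v := by
  induction hn : r v using Nat.strong_induction_on generalizing v with
  | _ n ih =>
    by_cases hvC : backNbrs G r v ⊆ C
    · exact ⟨[], .root v hv hvC⟩
    · obtain ⟨x, hx⟩ := hr.exists_isParent_of_not_subset hvC
      obtain ⟨l, hl⟩ := ih (r x) (hn ▸ (mem_backNbrs.1 hx.2.1).2) hx.1 rfl
      exact ⟨_, .step l x v hl hv hx⟩

end IsGrowthRank

namespace IsBranch

theorem notMem {l : List V} {v : V} (h : IsBranch G C r l v) : v ∉ C := by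
  cases h <;> assumption

theorem rank_lt {l : List V} {v : V} (h : IsBranch G C r l v) : ∀ x ∈ l, r x < r v := by
  induction h with
  | root => simp
  | step l x v _ _ hp ih =>
    have hxv := (mem_backNbrs.1 hp.2.1).2
    intro y hy
    rcases List.mem_append.1 hy with hy | hy
    · exact (ih y hy).trans hxv
    · rwa [List.mem_singleton.1 hy]

theorem notMem_of_mem {l : List V} {v : V} (h : IsBranch G C r l v) :
    ∀ x ∈ l ++ [v], x ∉ C := by
  induction h with
  | root v hv _ => simpa using hv
  | step l x v _ hv _ ih =>
    intro y hy
    rcases List.mem_append.1 hy with hy | hy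
    · exact ih y hy
    · rwa [List.mem_singleton.1 hy]

theorem notMem_list {l : List V} {v : V} (h : IsBranch G C r l v) : v ∉ l :=
  fun hv => (h.rank_lt v hv).false

theorem nodup {l : List V} {v : V} (h : IsBranch G C r l v) : (l ++ [v]).Nodup := by
  induction h with
  | root => simp
  | step l x v hb hv hp ih =>
    simpa using ih.concat (IsBranch.step l x v hb hv hp).notMem_list

theorem backNbrs_subset {l : List V} {v : V} (h : IsBranch G C r l v) :
    ∀ z ∈ backNbrs G r v, z ∈ C ∨ z ∈ l := by
  induction h with
  | root v _ hv => exact fun z hz => .inl (hv hz)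
  | step l x v _ _ hp ih =>
    intro z hz
    rcases hp.2.2 z hz with rfl | hz
    · simp
    · rcases ih z hz with h | h <;> simp [h]

theorem adj_iff (hr : IsGrowthRank G k C r) {l : List V} {v : V} (h : IsBranch G C r l v)
    {w : V} (hw : w ∈ C ∨ w ∈ l) : G.Adj v w ↔ w ∈ backNbrs G r v := by
  rw [mem_backNbrs]
  refine ⟨fun ha => ⟨ha, ?_⟩, fun ha => ha.1⟩
  rcases hw with hw | hw
  · have h1 := (hr.eq_zero_iff w).2 hw
    have h2 : r v ≠ 0 := fun h0 => h.notMem ((hr.eq_zero_iff v).1 h0)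
    omega
  · exact h.rank_lt w hw

theorem ncard_neighborSet (hr : IsGrowthRank G k C r) {l : List V} {v : V}
    (h : IsBranch G C r l v) :
    (G.neighborSet v ∩ ((↑C : Set V) ∪ {x | x ∈ l})).ncard = k := by
  have : G.neighborSet v ∩ ((↑C : Set V) ∪ {x | x ∈ l}) = ↑(backNbrs G r v) := by
    ext w
    constructor
    · exact fun hw => (h.adj_iff hr hw.2).1 hw.1
    · exact fun hw => ⟨(mem_backNbrs.1 hw).1, h.backNbrs_subset w hw⟩
  rw [this, Set.ncard_coe_finset, (hr.isNClique v h.notMem).card_eq]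

theorem head_or_infix {l : List V} {v : V} (h : IsBranch G C r l v) :
    ∀ y ∈ l ++ [v], (backNbrs G r y ⊆ C ∧ (l ++ [v]).head? = some y) ∨
      ∃ x, IsParent G C r x y ∧ [x, y] <:+: l ++ [v] := by
  induction h with
  | root v hv hs =>
    intro y hy
    have : y = v := by simpa using hy
    subst this
    exact .inl ⟨hs, rfl⟩
  | step l x v hb hv hp ih =>
    intro y hy
    rcases List.mem_append.1 hy with hy | hy
    · rcases ih y hy with ⟨h1, h2⟩ | ⟨u, h1, h2⟩
      · exact .inl ⟨h1, by rw [List.head?_append, h2]; rfl⟩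
      · exact .inr ⟨u, h1, h2.trans (List.prefix_append _ _).isInfix⟩
    · rw [List.mem_singleton.1 hy]
      exact .inr ⟨x, hp, ⟨l, [], by simp⟩⟩

variable [DecidableEq V]

theorem isPEO (hr : IsGrowthRank G k C r) {l : List V} {v : V} (h : IsBranch G C r l v) :
    IsPEO G k C (l ++ [v]) := by
  induction h with
  | root v hv hs =>
    exact .snoc [] v .nil hv (by simp) (ncard_neighborSet hr (.root v hv hs))
  | step l x v hb hv hp ih =>
    have h := IsBranch.step l x v hb hv hp
    exact .snoc _ v ih hv h.notMem_list (h.ncard_neighborSet hr)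

theorem isPathTypeOn (hr : IsGrowthRank G k C r) (hC : G.IsNClique k C) {l : List V} {v : V}
    (h : IsBranch G C r l v) : IsPathTypeOn G k (C ∪ (l ++ [v]).toFinset) := by
  induction h with
  | root v hv hs =>
    have e : C ∪ ([] ++ [v]).toFinset = insert v C := by ext; simp
    rw [e]
    refine .base₂ _ (hC.insert fun b hb => ?_)
    rw [← hr.backNbrs_eq_of_subset hC hv hs] at hb
    exact (mem_backNbrs.1 hb).1
  | step l x v hb hv hp ih =>
    have h := IsBranch.step l x v hb hv hp
    have e : C ∪ (l ++ [x] ++ [v]).toFinset = insert v (C ∪ (l ++ [x]).toFinset) := by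
      ext; simp only [mem_union, List.mem_toFinset, List.mem_append, List.mem_singleton,
        mem_insert]; tauto
    rw [e]
    refine .grow _ v (backNbrs G r v) ih ?_ ?_ ?_ (hr.isNClique v hv) ⟨x, hp.2.1, ?_⟩ ?_
    · rw [← hC.card_eq, ← card_insert_of_notMem hb.notMem]
      apply card_le_card
      intro y
      simp only [mem_union, List.mem_toFinset, List.mem_append, List.mem_singleton, mem_insert]
      tauto
    · have := h.notMem_list
      simp only [mem_union, List.mem_toFinset]
      tauto
    · intro z hz
      simpa only [mem_union, List.mem_toFinset] using h.backNbrs_subset z hz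
    · rw [← hb.ncard_neighborSet hr]
      congr 1
      ext w
      simp only [Set.mem_inter_iff, SimpleGraph.mem_neighborSet, mem_coe, mem_union,
        List.mem_toFinset, List.mem_append, List.mem_singleton, Set.mem_union,
        Set.mem_ofPred_eq]
      have : w = x → ¬ G.Adj x w := by rintro rfl; exact G.irrefl
      tauto
    · intro w hw
      exact h.adj_iff hr (by simpa only [mem_union, List.mem_toFinset] using hw)

theorem exists_simplicial (hk : 1 ≤ k) (hr : IsGrowthRank G k C r) (hC : G.IsNClique k C)
    {l : List V} {v : V} (h : IsBranch G C r l v) :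
    ∃ a ∈ C, (l ≠ [] → a ∉ backNbrs G r v) ∧
      (G.neighborSet a ∩ ((↑C : Set V) ∪ {x | x ∈ l ++ [v]})).ncard = k := by
  have root_case : ∀ v, v ∉ C → backNbrs G r v ⊆ C → ∀ a ∈ C,
      (G.neighborSet a ∩ ((↑C : Set V) ∪ {x | x ∈ [] ++ [v]})).ncard = k := by
    intro v hv hs a ha
    have e : (↑C : Set V) ∪ {x | x ∈ [] ++ [v]} = ↑(insert v C) := by
      ext; simp [or_comm]
    have hav : a ∈ backNbrs G r v := hr.backNbrs_eq_of_subset hC hv hs ▸ ha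
    have e2 : G.neighborSet a ∩ (C : Set V) = ↑(C.erase a) := by
      ext w
      simp only [Set.mem_inter_iff, SimpleGraph.mem_neighborSet, mem_coe, mem_erase]
      exact ⟨fun hw => ⟨hw.1.ne', hw.2⟩, fun hw => ⟨hC.isClique ha hw.2 hw.1.symm, hw.2⟩⟩
    rw [e, ncard_neighborSet_inter_insert hv (mem_backNbrs.1 hav).1, e2, Set.ncard_coe_finset,
      card_erase_add_one ha, hC.card_eq]
  have drop_last : ∀ l v, IsBranch G C r l v → ∀ a ∈ C, a ∉ backNbrs G r v →
      (G.neighborSet a ∩ ((↑C : Set V) ∪ {x | x ∈ l ++ [v]})) =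
        G.neighborSet a ∩ ((↑C : Set V) ∪ {x | x ∈ l}) := by
    intro l v hb a ha hav
    ext w
    simp only [Set.mem_inter_iff, SimpleGraph.mem_neighborSet, mem_coe, List.mem_append,
      List.mem_singleton, Set.mem_union, Set.mem_ofPred_eq]
    have : w = v → ¬ G.Adj a w := by
      rintro rfl hadj
      exact hav ((hb.adj_iff hr (.inl ha)).1 hadj.symm)
    tauto
  induction h with
  | root v hv hs =>
    obtain ⟨a, ha⟩ : C.Nonempty := card_pos.1 (by rw [hC.card_eq]; omega)
    exact ⟨a, ha, by simp, root_case v hv hs a ha⟩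
  | step l x v hb hv hp ih =>
    have h := IsBranch.step l x v hb hv hp
    cases hb with
    | root _ hx hs =>
      obtain ⟨a, ha, hav⟩ : ∃ a ∈ C, a ∉ backNbrs G r v := by
        by_contra! hcon
        have := eq_of_subset_of_card_le hcon
          (by rw [(hr.isNClique v hv).card_eq, hC.card_eq])
        exact hx (this ▸ hp.2.1)
      exact ⟨a, ha, fun _ => hav, by rw [drop_last _ v h a ha hav, root_case x hx hs a ha]⟩
    | step l' x' _ hb' hx hp' =>
      obtain ⟨a, ha, hax, hd⟩ := ih
      have hav : a ∉ backNbrs G r v := fun hmem => by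
        rcases hp.2.2 a hmem with rfl | hmem
        · exact hx ha
        · exact hax (by simp) hmem
      exact ⟨a, ha, fun _ => hav, by rw [drop_last _ v h a ha hav, hd]⟩

theorem isCanonPath (hk : 1 ≤ k) (hr : IsGrowthRank G k C r) (hC : G.IsNClique k C)
    {l : List V} {v : V} (h : IsBranch G C r l v) : IsCanonPath G k C (l ++ [v]) := by
  obtain ⟨a, ha, -, hd⟩ := h.exists_simplicial hk hr hC
  exact ⟨by simp, h.nodup, h.notMem_of_mem, h.isPathTypeOn hr hC, ⟨a, ha, hd⟩, h.isPEO hr⟩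

end IsBranch

namespace IsGrowthRank

/-- Every vertex lies on a branch that ends in a `k`-leaf. -/
theorem exists_isBranch_leaf (hr : IsGrowthRank G k C r) {y : V} (hy : y ∉ C) :
    ∃ l v, IsBranch G C r l v ∧ y ∈ l ++ [v] ∧ (G.neighborSet v).ncard = k := by
  classical
  obtain ⟨l₀, hl₀⟩ := hr.exists_isBranch hy
  obtain ⟨v, hv, hmax⟩ := exists_max_image
    (Finset.univ.filter fun v => ∃ l, IsBranch G C r l v ∧ y ∈ l ++ [v]) r
    ⟨y, by simpa using ⟨l₀, hl₀⟩⟩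
  simp only [mem_filter, mem_univ, true_and] at hv hmax
  obtain ⟨l, hl, hyl⟩ := hv
  refine ⟨l, v, hl, hyl, ?_⟩
  have hno : ∀ z, v ∉ backNbrs G r z := by
    intro z hz
    obtain ⟨w, hw⟩ := hr.exists_isParent hl.notMem hz
    have hvw := (mem_backNbrs.1 hw.2.1).2
    refine (hmax w ⟨l ++ [v], .step l v w hl (hr.notMem_of_mem_backNbrs hw.2.1) hw, ?_⟩).not_gt
      hvw
    exact List.mem_append_left _ hyl
  have : G.neighborSet v = ↑(backNbrs G r v) := by
    ext w
    exact ⟨fun hw => (hr.mem_or_mem hw hl.notMem).resolve_left (hno w),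
      fun hw => (mem_backNbrs.1 hw).1⟩
  rw [this, Set.ncard_coe_finset, (hr.isNClique v hl.notMem).card_eq]

theorem mem_backNbrs_of_isChain (hr : IsGrowthRank G k C r) {x y z : V} {m : List V}
    (hm : List.IsChain (fun a b => a ∈ backNbrs G r b) (y :: m)) (hx : x ∉ C)
    (hlate : ∀ u ∈ y :: m, u ≠ x ∧ u ∉ backNbrs G r x) (hz : z ∈ y :: m)
    (hxz : x ∈ backNbrs G r z) : x ∈ backNbrs G r y := by
  induction m generalizing y with
  | nil => rwa [← List.mem_singleton.1 hz]
  | cons u m ih =>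
    rcases List.mem_cons.1 hz with rfl | hz
    · exact hxz
    · rw [List.isChain_cons_cons] at hm
      have hxu := ih hm.2 (fun w hw => hlate w (List.mem_cons_of_mem _ hw)) hz
      obtain ⟨hyx, hy⟩ := hlate y (by simp)
      exact (hr.mem_or_mem (hr.adj_of_mem_backNbrs hxu hm.1 hyx.symm) hx).resolve_right hy

variable [DecidableEq V]

/-- In an elimination list of a closed vertex set, earlier neighbours occur earlier. -/
theorem mem_of_isPEO (hr : IsGrowthRank G k C r) {L : List V} (h : IsPEO G k C L)
    (hcl : ∀ x ∈ L, ∀ u ∈ backNbrs G r x, u ∈ C ∨ u ∈ L) {l₁ l₂ : List V} {v u : V}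
    (hL : L = l₁ ++ v :: l₂) (hu : u ∈ backNbrs G r v) : u ∈ C ∨ u ∈ l₁ := by
  induction h generalizing l₁ l₂ v u with
  | nil => simp at hL
  | snoc l w hl hwC hwl hd ih =>
    have hw : ∀ u ∈ backNbrs G r w, u ∈ C ∨ u ∈ l := fun u hu => by
      have h1 := hcl w (by simp) u hu
      have h2 : u ≠ w := (mem_backNbrs.1 hu).1.ne'
      simpa [h2] using h1
    have heq : (↑(backNbrs G r w) : Set V) =
        G.neighborSet w ∩ ((↑C : Set V) ∪ {x | x ∈ l}) := by
      refine Set.eq_of_subset_of_ncard_le (fun u hu => ⟨(mem_backNbrs.1 hu).1, hw u hu⟩) ?_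
        (Set.toFinite _)
      rw [hd, Set.ncard_coe_finset, (hr.isNClique w hwC).card_eq]
    have hl' : ∀ x ∈ l, ∀ u ∈ backNbrs G r x, u ∈ C ∨ u ∈ l := by
      intro x hx u hu
      have h1 := hcl x (by simp [hx]) u hu
      have h2 : u ≠ w := by
        rintro rfl
        have : x ∈ (↑(backNbrs G r u) : Set V) := heq ▸ ⟨(mem_backNbrs.1 hu).1.symm, .inr hx⟩
        exact (mem_backNbrs.1 hu).2.not_gt (mem_backNbrs.1 this).2
      simpa [h2] using h1
    rcases List.eq_nil_or_concat l₂ with rfl | ⟨l₂, w', rfl⟩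
    · obtain ⟨rfl, h⟩ := List.append_inj' hL rfl
      obtain rfl : w = v := by simpa using h
      exact hw u hu
    · have hL' : l ++ [w] = (l₁ ++ v :: l₂) ++ [w'] := by simpa using hL
      exact ih hl' (List.append_inj' hL' rfl).1 hu

section Canon

variable {L : List V}

theorem mem_of_isCanonPath (hr : IsGrowthRank G k C r) (hC : G.IsNClique k C)
    (h : IsCanonPath G k C L) {l₁ l₂ : List V} {v u : V}
    (hL : L = l₁ ++ v :: l₂) (hu : u ∈ backNbrs G r v) : u ∈ C ∨ u ∈ l₁ := by
  obtain ⟨-, -, hLC, hp, -, hpeo⟩ := h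
  refine hr.mem_of_isPEO hpeo (fun x hx u hu => ?_) hL hu
  have := (hr.isKTreeOn_iff hC subset_union_left).1 hp.isKTreeOn x (by simp [hx]) (hLC x hx) hu
  simpa only [mem_union, List.mem_toFinset] using this

theorem notMem_backNbrs_of_isCanonPath (hr : IsGrowthRank G k C r) (hC : G.IsNClique k C)
    (h : IsCanonPath G k C L) {l₁ l₂ : List V} {v u : V}
    (hL : L = l₁ ++ v :: l₂) (hu : u ∈ l₁) : v ∉ backNbrs G r u := by
  intro hv
  obtain ⟨a, b, rfl⟩ := List.append_of_mem hu
  rcases hr.mem_of_isCanonPath hC h (l₁ := a) (l₂ := b ++ v :: l₂) (by simp [hL]) hv with h' | h'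
  · exact h.2.2.1 v (by simp [hL]) h'
  · have := h.2.1
    rw [hL] at this
    exact (List.nodup_append.1 this).2.2 v (by simp [h']) v (by simp) rfl

theorem ncard_neighborSet_of_isCanonPath (hr : IsGrowthRank G k C r) (hC : G.IsNClique k C)
    (h : IsCanonPath G k C L) {l₁ l₂ : List V} {v : V}
    (hL : L = l₁ ++ v :: l₂) (hlate : ∀ z ∈ l₂, v ∉ backNbrs G r z) :
    (G.neighborSet v ∩ ((C ∪ L.toFinset : Finset V) : Set V)).ncard = k := by
  have hvC := h.2.2.1 v (by simp [hL])
  have : G.neighborSet v ∩ ((C ∪ L.toFinset : Finset V) : Set V) = ↑(backNbrs G r v) := by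
    ext u
    simp only [Set.mem_inter_iff, SimpleGraph.mem_neighborSet, mem_coe, mem_union,
      List.mem_toFinset]
    constructor
    · rintro ⟨hadj, hu⟩
      refine (hr.mem_or_mem hadj hvC).resolve_left fun hmem => ?_
      have hu := hu.resolve_left (hr.notMem_of_mem_backNbrs hmem)
      rw [hL, List.mem_append, List.mem_cons] at hu
      rcases hu with hu | rfl | hu
      · exact hr.notMem_backNbrs_of_isCanonPath hC h hL hu hmem
      · exact G.irrefl hadj
      · exact hlate u hu hmem
    · intro hu
      refine ⟨(mem_backNbrs.1 hu).1, (hr.mem_of_isCanonPath hC h hL hu).imp_right fun hu => ?_⟩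
      simp [hL, hu]
  rw [this, Set.ncard_coe_finset, (hr.isNClique v hvC).card_eq]

/-- All vertices of a canonical list but the last have a later neighbour in it. -/
theorem exists_later_of_isCanonPath (hr : IsGrowthRank G k C r) (hC : G.IsNClique k C)
    (h : IsCanonPath G k C L) {l₁ l₂ : List V} {x : V}
    (hL : L = l₁ ++ x :: l₂) (hne : l₂ ≠ []) : ∃ z ∈ l₂, x ∈ backNbrs G r z := by
  by_contra! hcon
  have hxk := hr.ncard_neighborSet_of_isCanonPath hC h hL hcon
  obtain ⟨m, v, rfl⟩ := (List.eq_nil_or_concat l₂).resolve_left hne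
  have hvk := hr.ncard_neighborSet_of_isCanonPath hC h (l₁ := l₁ ++ x :: m) (l₂ := []) (v := v)
    (by simp [hL]) (by simp)
  obtain ⟨-, hnd, hLC, hp, ⟨a, ha, hak⟩, -⟩ := h
  have hx : x ∈ L := by simp [hL]
  have hv : v ∈ L := by simp [hL]
  have hxv : x ≠ v := by
    rintro rfl
    rw [hL] at hnd
    exact (List.nodup_cons.1 (List.nodup_append.1 hnd).2.1).1 (by simp)
  have hak : (G.neighborSet a ∩ ((C ∪ L.toFinset : Finset V) : Set V)).ncard = k := by
    rw [← hak]
    congr 2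
    ext; simp
  have hxC := hLC x hx
  have hvC := hLC v hv
  obtain ⟨T, hT, hTl⟩ := hp.exists_leaf_pair (by
    have h1 : insert x (insert v C) ⊆ C ∪ L.toFinset := by
      intro u
      simp only [mem_insert, mem_union, List.mem_toFinset]
      rintro (rfl | rfl | hu) <;> simp [*]
    have h2 := card_le_card h1
    rw [card_insert_of_notMem (by simp [hxv, hxC]), card_insert_of_notMem hvC,
      hC.card_eq] at h2
    exact h2)
  have hsub : ({a, x, v} : Finset V) ⊆ T := by
    intro u hu
    simp only [mem_insert, mem_singleton] at hu
    rcases hu with rfl | rfl | rfl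
    · exact hTl _ (by simp [ha]) hak
    · exact hTl _ (by simp [hx]) hxk
    · exact hTl _ (by simp [hv]) hvk
  have hax : a ≠ x := fun e => hxC (e ▸ ha)
  have hav : a ≠ v := fun e => hvC (e ▸ ha)
  have := card_le_card hsub
  rw [card_eq_three.2 ⟨a, x, v, hax, hav, hxv, rfl⟩] at this
  omega

theorem isChain_of_isCanonPath (hr : IsGrowthRank G k C r) (hC : G.IsNClique k C)
    (h : IsCanonPath G k C L) {l₁ l₂ : List V} {x : V} (hL : L = l₁ ++ x :: l₂) :
    List.IsChain (fun a b => a ∈ backNbrs G r b) (x :: l₂) := by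
  induction l₂ generalizing l₁ x with
  | nil => simp
  | cons y m ih =>
    have hm := ih (l₁ := l₁ ++ [x]) (x := y) (by simp [hL])
    obtain ⟨z, hz, hxz⟩ := hr.exists_later_of_isCanonPath hC h hL (by simp)
    refine List.isChain_cons_cons.2 ⟨?_, hm⟩
    refine hr.mem_backNbrs_of_isChain hm (h.2.2.1 x (by simp [hL])) (fun u hu => ?_) hz hxz
    have hnd := h.2.1
    rw [hL, List.nodup_append] at hnd
    refine ⟨fun e => (List.nodup_cons.1 hnd.2.1).1 (e ▸ hu), fun hux => ?_⟩
    rcases hr.mem_of_isCanonPath hC h hL hux with hu' | hu'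
    · exact h.2.2.1 u (by simp only [hL, List.mem_append]; exact .inr (by simp [hu])) hu'
    · exact hnd.2.2 u hu' u (List.mem_cons_of_mem _ hu) rfl

theorem isParent_of_isCanonPath (hr : IsGrowthRank G k C r) (hC : G.IsNClique k C)
    (h : IsCanonPath G k C L) {x y : V} (hxy : [x, y] <:+: L) : IsParent G C r x y := by
  obtain ⟨s, t, hL⟩ := hxy
  have hL₁ : L = s ++ x :: y :: t := by simp [← hL]
  have hL₂ : L = (s ++ [x]) ++ y :: t := by simp [← hL]
  have hx := h.2.2.1 x (by simp [hL₁])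
  have hmem := (List.isChain_cons_cons.1 (hr.isChain_of_isCanonPath hC h hL₁)).1
  refine ⟨hx, hmem, fun z hz => or_iff_not_imp_left.2 fun hne => ?_⟩
  refine (hr.mem_or_mem (hr.adj_of_mem_backNbrs hmem hz (Ne.symm hne)) hx).resolve_left
    fun hxz => ?_
  rcases hr.mem_of_isCanonPath hC h hL₂ hz with hzC | hzs
  · exact hr.notMem_of_mem_backNbrs hxz hzC
  · have hzs : z ∈ s := by simpa [hne] using hzs
    exact hr.notMem_backNbrs_of_isCanonPath hC h hL₁ hzs hxz

theorem backNbrs_subset_of_isCanonPath (hr : IsGrowthRank G k C r) (hC : G.IsNClique k C)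
    (h : IsCanonPath G k C L) {y : V} (hy : L.head? = some y) : backNbrs G r y ⊆ C := by
  obtain ⟨l, rfl⟩ := List.head?_eq_some_iff.1 hy
  intro z hz
  simpa using hr.mem_of_isCanonPath hC h (l₁ := []) rfl hz

end Canon

/-- The characteristic `1`-tree is the rooted tree given by the parent function. -/
theorem exists_parent_function (hk : 1 ≤ k) (hr : IsGrowthRank G k C r)
    (hC : G.IsNClique k C) :
    ∃ f : {x // x ∉ C} → Option {x // x ∉ C},
      (∀ x y, f y = some x ↔ IsParent G C r x.1 y.1) ∧
      ∀ a b, (charTree G k C).Adj a b ↔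
        (∃ y, b = some y ∧ f y = a) ∨ ∃ y, a = some y ∧ f y = b := by
  have hex : ∀ y : {x // x ∉ C}, ∃ a : Option {x // x ∉ C},
      (a = none ↔ backNbrs G r y.1 ⊆ C) ∧ ∀ x, a = some x ↔ IsParent G C r x.1 y.1 := by
    intro y
    by_cases hy : backNbrs G r y.1 ⊆ C
    · exact ⟨none, by simp [hy], fun x =>
        iff_of_false (by simp) fun hp => hp.1 (hy hp.2.1)⟩
    · obtain ⟨x, hx⟩ := hr.exists_isParent_of_not_subset hy
      refine ⟨some ⟨x, hx.1⟩, by simp [hy], fun x' => ?_⟩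
      rw [Option.some_inj]
      exact ⟨fun e => e ▸ hx, fun hx' => Subtype.ext (isParent_unique hx hx')⟩
  choose f hf₀ hf using hex
  refine ⟨f, fun x y => hf y x, fun a b => ?_⟩
  have hrel : ∀ a b : Option {x // x ∉ C}, (∃ L : List V, IsCanonPath G k C L ∧
      (∃ v, L.getLast? = some v ∧ (G.neighborSet v).ncard = k) ∧
      ((a = none ∧ ∃ y : {x : V // x ∉ C}, b = some y ∧ L.head? = some y.val) ∨
        (∃ x y : {x : V // x ∉ C}, a = some x ∧ b = some y ∧ [x.val, y.val] <:+: L))) ↔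
      ∃ y, b = some y ∧ f y = a := by
    intro a b
    constructor
    · rintro ⟨L, hL, -, ⟨rfl, y, rfl, hy⟩ | ⟨x, y, rfl, rfl, hxy⟩⟩
      · exact ⟨y, rfl, (hf₀ y).2 (hr.backNbrs_subset_of_isCanonPath hC hL hy)⟩
      · exact ⟨y, rfl, (hf y x).2 (hr.isParent_of_isCanonPath hC hL hxy)⟩
    · rintro ⟨y, rfl, rfl⟩
      obtain ⟨l, v, hl, hy, hv⟩ := hr.exists_isBranch_leaf y.2
      refine ⟨l ++ [v], hl.isCanonPath hk hr hC, ⟨v, by simp, hv⟩, ?_⟩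
      rcases hl.head_or_infix y.1 hy with ⟨h1, h2⟩ | ⟨x, h1, h2⟩
      · exact .inl ⟨(hf₀ y).2 h1, y, rfl, h2⟩
      · exact .inr ⟨⟨x, h1.1⟩, y, (hf y _).2 h1, rfl, h2⟩
  rw [charTree, SimpleGraph.fromRel_adj, hrel, hrel]
  refine ⟨fun h => h.2.imp_right fun ⟨y, h1, h2⟩ => ⟨y, h1, h2⟩, fun h => ⟨?_, h⟩⟩
  have hne : ∀ y, f y ≠ some y := fun y hy =>
    (mem_backNbrs.1 ((hf y y).1 hy).2.1).2.false
  rintro rfl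
  rcases h with ⟨y, h1, h2⟩ | ⟨y, h1, h2⟩ <;> exact hne y (h2.trans h1)

end IsGrowthRank

end Rank

/-- In a tree rooted at `none` with parent function `f`, a vertex set containing the root
induces a connected subgraph if and only if it is closed under taking parents. -/
theorem connected_induce_iff_parent_mem {S : Type*} {H : SimpleGraph (Option S)}
    {f : S → Option S} {ρ : S → ℕ} (hρ : ∀ x y, f y = some x → ρ x < ρ y)
    (hH : ∀ a b, H.Adj a b ↔ (∃ y, b = some y ∧ f y = a) ∨ ∃ y, a = some y ∧ f y = b)
    {B : Set (Option S)} (h0 : none ∈ B) :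
    (H.induce B).Connected ↔ ∀ y, some y ∈ B → f y ∈ B := by
  constructor
  · intro hcon y hy
    by_contra hfy
    let D : Option S → Prop :=
      Relation.ReflTransGen (fun a b => ∃ w, b = some w ∧ f w = a) (some y)
    have hstep : ∀ a b : B, (H.induce B).Adj a b → D a → D b := by
      rintro ⟨a, ha⟩ ⟨b, hb⟩ hab hDa
      rcases (hH a b).1 hab with hw | ⟨w, rfl, hw⟩
      · exact hDa.tail hw
      · rcases Relation.ReflTransGen.cases_tail hDa with e | ⟨c, hc, w', hw', hfw⟩
        · obtain rfl : w = y := by simpa using e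
          exact (hfy (hw ▸ hb)).elim
        · obtain rfl : w = w' := by simpa using hw'
          rwa [← hfw, hw] at hc
    have hreach : ∀ a b : B, (H.induce B).Reachable a b → D a → D b := by
      rintro a b ⟨p⟩
      induction p with
      | nil => exact id
      | cons h _ ih => exact fun ha => ih (hstep _ _ h ha)
    have := hreach ⟨some y, hy⟩ ⟨none, h0⟩ (hcon.preconnected _ _) .refl
    rcases Relation.ReflTransGen.cases_tail this with e | ⟨c, -, w, hw, -⟩
    · simp at e
    · simp at hw
  · intro hcl
    have hroot : ∀ n, ∀ y (hy : some y ∈ B), ρ y = n →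
        (H.induce B).Reachable ⟨none, h0⟩ ⟨some y, hy⟩ := by
      intro n
      induction n using Nat.strong_induction_on with
      | _ n ih =>
        intro y hy hn
        have hadj : (H.induce B).Adj ⟨f y, hcl y hy⟩ ⟨some y, hy⟩ :=
          (hH _ _).2 (.inl ⟨y, rfl, rfl⟩)
        refine SimpleGraph.Reachable.trans ?_ hadj.reachable
        have key : ∀ a (ha : a ∈ B), f y = a → (H.induce B).Reachable ⟨none, h0⟩ ⟨a, ha⟩ := by
          rintro (_ | x) ha e
          · exact .refl _
          · exact ih (ρ x) (hn ▸ hρ x y e) x ha rfl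
        exact key _ _ rfl
    have hall : ∀ b : B, (H.induce B).Reachable ⟨none, h0⟩ b := by
      rintro ⟨_ | y, hb⟩
      · exact .refl _
      · exact hroot _ y hb rfl
    have : Nonempty B := ⟨⟨none, h0⟩⟩
    exact ⟨fun a b => (hall a).symm.trans (hall b)⟩

/-- For a nontrivial `k`-tree `T` and a `k`-clique `C` of `T`, there is
a bijection between the sub-`k`-trees of `T` containing `C` and the subtrees of the
characteristic `1`-tree `T'_C` containing the vertex `C` (here `none`), under which a
sub-`k`-tree of order `m` corresponds to a subtree of order `m - k + 1`. -/
theorem subKTrees_equiv_charTree_subtrees {V : Type*} [Fintype V] [DecidableEq V]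
    (k : ℕ) (hk : 1 ≤ k) (G : SimpleGraph V) (hG : IsKTree G k)
    (hnontriv : k < Fintype.card V) (C : Finset V) (hC : G.IsNClique k C) :
    ∃ e : {A : Finset V // A ∈ subKTrees G k C} ≃
        {B : Finset (Option {x : V // x ∉ C}) // B ∈ subtrees (charTree G k C) none},
      ∀ A, ((e A : Finset (Option {x : V // x ∉ C})).card + k = (A : Finset V).card + 1) := by
  obtain ⟨r, hr⟩ := (hG.growsFrom hC (subset_univ C)).exists_isGrowthRank
  obtain ⟨f, hf, hadj⟩ := hr.exists_parent_function hk hC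
  have hA : ∀ A : Finset V, A ∈ subKTrees G k C ↔
      C ⊆ A ∧ ∀ y ∈ A, ∀ x, IsParent G C r x y → x ∈ A := by
    intro A
    simp only [subKTrees, mem_filter, mem_univ, true_and]
    exact and_congr_right fun h => by
      rw [hr.isKTreeOn_iff hC h, hr.backNbrs_subset_iff_parent_mem h]
  have hB : ∀ B : Finset (Option {x : V // x ∉ C}), B ∈ subtrees (charTree G k C) none ↔
      none ∈ B ∧ ∀ y, some y ∈ B → f y ∈ B := by
    intro B
    simp only [subtrees, subtreesIn, mem_filter, mem_univ, true_and, Set.subset_univ]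
    refine and_congr_right fun h => ?_
    exact connected_induce_iff_parent_mem (ρ := fun x => r x.1)
      (fun x y h => (mem_backNbrs.1 ((hf x y).1 h).2.1).2) hadj h
  let F : Finset V → Finset (Option {x : V // x ∉ C}) := fun A =>
    insertNone (A.subtype (· ∉ C))
  let E : Finset (Option {x : V // x ∉ C}) → Finset V := fun B =>
    C ∪ (eraseNone B).map (Function.Embedding.subtype _)
  have hFn : ∀ A, none ∈ F A := fun A => by simp [F]
  have hFs : ∀ A y, some y ∈ F A ↔ y.1 ∈ A := fun A y => by simp [F]
  have hE : ∀ B v, v ∈ E B ↔ v ∈ C ∨ ∃ h : v ∉ C, some ⟨v, h⟩ ∈ B := fun B v => by simp [E]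
  have hF : ∀ A, A ∈ subKTrees G k C → F A ∈ subtrees (charTree G k C) none := by
    intro A h
    rw [hA] at h
    rw [hB]
    refine ⟨hFn A, fun y hy => ?_⟩
    rcases e : f y with _ | x
    · exact hFn A
    · exact (hFs A x).2 (h.2 y ((hFs A y).1 hy) x ((hf x y).1 e))
  have hE' : ∀ B, B ∈ subtrees (charTree G k C) none → E B ∈ subKTrees G k C := by
    intro B h
    rw [hB] at h
    rw [hA]
    refine ⟨subset_union_left, fun y hy x hx => ?_⟩
    obtain ⟨hyC, hyB⟩ := ((hE B y).1 hy).resolve_left (hr.notMem_of_mem_backNbrs hx.2.1)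
    have := h.2 _ hyB
    rw [(hf ⟨x, hx.1⟩ ⟨y, hyC⟩).2 hx] at this
    exact (hE B x).2 (.inr ⟨hx.1, this⟩)
  refine ⟨⟨fun A => ⟨F A, hF A A.2⟩, fun B => ⟨E B, hE' B B.2⟩, ?_, ?_⟩, ?_⟩
  · rintro ⟨A, h⟩
    refine Subtype.ext (Finset.ext fun v => ?_)
    have hCA := ((hA A).1 h).1
    simp only [hE, hFs]
    by_cases hv : v ∈ C
    · simp [hv, hCA hv]
    · simp [hv]
  · rintro ⟨B, h⟩
    refine Subtype.ext (Finset.ext fun o => ?_)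
    rcases o with _ | ⟨y, hy⟩
    · simp [hFn, ((hB B).1 h).1]
    · simp [hFs, hE, hy]
  · rintro ⟨A, h⟩
    have hCA := ((hA A).1 h).1
    have h1 : (A.filter (· ∉ C)).card = A.card - k := by
      rw [filter_notMem_eq_sdiff, card_sdiff_of_subset hCA, hC.card_eq]
    have h2 := card_le_card hCA
    rw [hC.card_eq] at h2
    simp only [Equiv.coe_fn_mk, F, card_insertNone, card_subtype, h1]
    omega
end
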